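/- Let n_q, n_c, m, n_yq, n_yc be natural numbers with n_yq ≤ m, and set Θ_q = diag_{n_q}(J), Θ_w = diag_m(J), Θ_yq = diag_{n_yq}(J). Let A_cq (n_c×2n_q), B_q (2n_q×2m), B_c (n_c×2m), C_qc (2n_yq×n_c), C_cq (n_yc×2n_q), D_q (2n_yq×2m), D_c (n_yc×2m), and D'_q ((2m−2n_yq)×2m) be real matrices satisfying: D_q·Θ_w·D_qᵀ = Θ_yq, D_q·Θ_w·D_cᵀ = 0, D_c·Θ_w·D_cᵀ = 0, A_cq·Θ_q + B_c·Θ_w·B_qᵀ = 0, B_c·Θ_w·B_cᵀ = 0, B_c·Θ_w·D_qᵀ = 0, B_c·Θ_w·D_cᵀ = 0, B_q·Θ_w·D_cᵀ = −Θ_q·C_cqᵀ, and [D_q; D'_q]·Θ_w·[D_q; D'_q]ᵀ = Θ_w. Define C'_qq = D'_q·Θ_w·B_qᵀ·Θ_q and Θ_{y'} = D'_q·Θ_w·D'_qᵀ. Then Θ_{y'} = diag_{m−n_yq}(J), and there exist real matrices C'_c (2m×n_c), B̄_c (n_c×(2m−2n_yq)), D̄_c (n_yc×(2m−2n_yq))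 such that D_q·C'_c = C_qc, B̄_c·C'_qq = A_cq, B̄_c·D'_q = B_c, D̄_c·C'_qq = C_cq, D̄_c·D'_q = D_c, and [B̄_c; D̄_c]·Θ_{y'}·[B̄_c; D̄_c]ᵀ = 0. -/

import Mathlib

open Matrix

/-- The 2×2 real matrix `J = [[0,1],[-1,0]]`. -/
def Jmat : Matrix (Fin 2) (Fin 2) ℝ := !![0, 1; -1, 0]

/-- `diagJ k` is the `2k × 2k` block-diagonal real matrix with `k` copies of `J`. -/
def diagJ (k : ℕ) : Matrix (Fin (2 * k)) (Fin (2 * k)) ℝ :=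
  Matrix.of fun i j =>
    if i.val / 2 = j.val / 2 then
      Jmat ⟨i.val % 2, Nat.mod_lt _ two_pos⟩ ⟨j.val % 2, Nat.mod_lt _ two_pos⟩
    else 0

theorem diagJ_transpose (k : ℕ) : (diagJ k)ᵀ = -diagJ k := by
  ext i j
  have hi := Nat.mod_two_eq_zero_or_one i.val
  have hj := Nat.mod_two_eq_zero_or_one j.val
  rcases hi with hi | hi <;> rcases hj with hj | hj <;>
    by_cases h : j.val / 2 = i.val / 2 <;>
    simp [diagJ, Jmat, hi, hj, h, eq_comm (a := i.val / 2)]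

theorem diagJ_mul_self (k : ℕ) : diagJ k * diagJ k = -1 := by
  ext i j
  have hil := i.isLt
  let p : Fin (2 * k) := ⟨2 * (i.val / 2) + (1 - i.val % 2), by omega⟩
  have hp : p.val / 2 = i.val / 2 := by simp only [p]; omega
  have hpm : p.val % 2 = 1 - i.val % 2 := by simp only [p]; omega
  rw [Matrix.mul_apply, Finset.sum_eq_single p]
  · simp only [diagJ, of_apply, hp, if_true, Matrix.neg_apply, Matrix.one_apply, Fin.ext_iff, hpm]
    by_cases h : i.val / 2 = j.val / 2
    · rcases Nat.mod_two_eq_zero_or_one i.val with hi | hi <;>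
        rcases Nat.mod_two_eq_zero_or_one j.val with hj | hj
      · simp [hj, Jmat, show i.val = j.val by omega]
      · simp [h, hi, hj, Jmat, show i.val ≠ j.val by omega]
      · simp [h, hi, hj, Jmat, show i.val ≠ j.val by omega]
      · simp [hj, Jmat, show i.val = j.val by omega]
    · simp [h, show i.val ≠ j.val by rintro h'; exact h (by rw [h'])]
  · intro b _ hb
    by_cases h : i.val / 2 = b.val / 2
    · have hbm : b.val % 2 = i.val % 2 := by
        by_contra hne
        exact hb (Fin.ext (by simp only [p]; omega))
      rcases Nat.mod_two_eq_zero_or_one i.val with hi | hi <;>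
        simp [diagJ, Jmat, hbm, hi]
    · simp [diagJ, h]
  · simp

/-- If `V` carries a complex structure `K` to a complex structure `S` by congruence, then `Vᵀ`
carries `S` back to `K`. -/
theorem transpose_mul_mul_eq_of_mul_mul_transpose_eq {R m n : Type*} [CommRing R]
    [Fintype m] [DecidableEq m] [Fintype n] [DecidableEq n] (e : m ≃ n)
    {K : Matrix n n R} {S : Matrix m m R} {V : Matrix m n R}
    (hK : K * K = -1) (hS : S * S = -1) (h : V * K * Vᵀ = S) : Vᵀ * S * V = K := by
  have h1 : V * (K * Vᵀ * -S) = 1 := by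
    rw [← Matrix.mul_assoc, ← Matrix.mul_assoc, h, Matrix.mul_neg, hS, neg_neg]
  have h2 : (K * Vᵀ * -S) * V = 1 := (Matrix.mul_eq_one_comm_of_equiv e).1 h1
  calc Vᵀ * S * V = -(K * K) * (Vᵀ * S * V) := by rw [hK, neg_neg, Matrix.one_mul]
    _ = K * ((K * Vᵀ * -S) * V) := by
      simp only [Matrix.mul_neg, Matrix.neg_mul, Matrix.mul_assoc]
    _ = K := by rw [h2, Matrix.mul_one]

/-- Existence of all interconnection matrices of the feedback network realizing a physically
realizable standard-form mixed quantum-classical system as a quantum system in feedback with a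
classical system. -/
theorem synthesis_interconnection_matrices (n_q n_c m n_yq n_yc : ℕ) (hyq : n_yq ≤ m)
    (Acq : Matrix (Fin n_c) (Fin (2 * n_q)) ℝ)
    (Bq : Matrix (Fin (2 * n_q)) (Fin (2 * m)) ℝ)
    (Bc : Matrix (Fin n_c) (Fin (2 * m)) ℝ)
    (Cqc : Matrix (Fin (2 * n_yq)) (Fin n_c) ℝ)
    (Ccq : Matrix (Fin n_yc) (Fin (2 * n_q)) ℝ)
    (Dq : Matrix (Fin (2 * n_yq)) (Fin (2 * m)) ℝ)
    (Dc : Matrix (Fin n_yc) (Fin (2 * m)) ℝ)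
    (Dq' : Matrix (Fin (2 * m - 2 * n_yq)) (Fin (2 * m)) ℝ)
    (h1 : Dq * diagJ m * Dqᵀ = diagJ n_yq)
    (h2 : Dq * diagJ m * Dcᵀ = 0)
    (h3 : Dc * diagJ m * Dcᵀ = 0)
    (h4 : Acq * diagJ n_q + Bc * diagJ m * Bqᵀ = 0)
    (h5 : Bc * diagJ m * Bcᵀ = 0)
    (h6 : Bc * diagJ m * Dqᵀ = 0)
    (h7 : Bc * diagJ m * Dcᵀ = 0)
    (h8 : Bq * diagJ m * Dcᵀ = -(diagJ n_q * Ccqᵀ))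
    (hV : Matrix.fromRows Dq Dq' * diagJ m * (Matrix.fromRows Dq Dq')ᵀ =
        (diagJ m).submatrix
          (finSumFinEquiv.trans (finCongr (by omega : 2 * n_yq + (2 * m - 2 * n_yq) = 2 * m)))
          (finSumFinEquiv.trans (finCongr (by omega : 2 * n_yq + (2 * m - 2 * n_yq) = 2 * m)))) :
    Dq' * diagJ m * Dq'ᵀ =
      (diagJ (m - n_yq)).submatrix
        (finCongr (by omega : 2 * m - 2 * n_yq = 2 * (m - n_yq)))
        (finCongr (by omega : 2 * m - 2 * n_yq = 2 * (m - n_yq))) ∧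
    ∃ (Cc' : Matrix (Fin (2 * m)) (Fin n_c) ℝ)
      (Bcbar : Matrix (Fin n_c) (Fin (2 * m - 2 * n_yq)) ℝ)
      (Dcbar : Matrix (Fin n_yc) (Fin (2 * m - 2 * n_yq)) ℝ),
      Dq * Cc' = Cqc ∧
      Bcbar * (Dq' * diagJ m * Bqᵀ * diagJ n_q) = Acq ∧
      Bcbar * Dq' = Bc ∧
      Dcbar * (Dq' * diagJ m * Bqᵀ * diagJ n_q) = Ccq ∧
      Dcbar * Dq' = Dc ∧
      Matrix.fromRows Bcbar Dcbar * (Dq' * diagJ m * Dq'ᵀ) *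
        (Matrix.fromRows Bcbar Dcbar)ᵀ = 0 := by
  have hS := hV
  rw [fromRows_mul, transpose_fromRows, fromRows_mul_fromCols] at hS
  have hT : Dq' * diagJ m * Dq'ᵀ =
      (diagJ (m - n_yq)).submatrix
        (finCongr (by omega : 2 * m - 2 * n_yq = 2 * (m - n_yq)))
        (finCongr (by omega : 2 * m - 2 * n_yq = 2 * (m - n_yq))) := by
    ext i j
    have h := congrFun (congrFun hS (Sum.inr i)) (Sum.inr j)
    rw [fromBlocks_apply₂₂] at h
    rw [h]
    simp [diagJ, Nat.mul_add_div]
  have h12 : Dq * diagJ m * Dq'ᵀ = 0 := by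
    ext i j
    have h := congrFun (congrFun hS (Sum.inl i)) (Sum.inr j)
    rw [fromBlocks_apply₁₂] at h
    have hi := i.isLt
    rw [h]
    simp only [diagJ, submatrix_apply, of_apply, Equiv.trans_apply, finSumFinEquiv_apply_left,
      finSumFinEquiv_apply_right, finCongr_apply, Fin.val_cast, Fin.val_castAdd, Fin.val_natAdd,
      Matrix.zero_apply]
    rw [if_neg (by omega)]
  have h21 : Dq' * diagJ m * Dqᵀ = 0 := by
    have h := congrArg transpose h12
    simpa [transpose_mul, diagJ_transpose, Matrix.mul_assoc] using h
  have hVS : (fromRows Dq Dq')ᵀ *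
      fromBlocks (diagJ n_yq) 0 0 (Dq' * diagJ m * Dq'ᵀ) * fromRows Dq Dq' = diagJ m := by
    have hSq : fromBlocks (diagJ n_yq) 0 0 (Dq' * diagJ m * Dq'ᵀ) *
        fromBlocks (diagJ n_yq) 0 0 (Dq' * diagJ m * Dq'ᵀ) = -1 := by
      rw [hT, fromBlocks_multiply, submatrix_mul_equiv, diagJ_mul_self, diagJ_mul_self,
        ← fromBlocks_one, fromBlocks_neg]
      simp [submatrix_neg]
    refine transpose_mul_mul_eq_of_mul_mul_transpose_eq
      (finSumFinEquiv.trans (finCongr (by omega))) (diagJ_mul_self m) hSq ?_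
    rw [fromRows_mul, transpose_fromRows, fromRows_mul_fromCols, h1, h12, h21]
  set T := Dq' * diagJ m * Dq'ᵀ with hTdef
  have hsum : Dqᵀ * diagJ n_yq * Dq + Dq'ᵀ * T * Dq' = diagJ m := by
    simpa [transpose_fromRows, fromCols_mul_fromBlocks, fromCols_mul_fromRows] using hVS
  have hlift {r : ℕ} (X : Matrix (Fin r) (Fin (2 * m)) ℝ) (hX : X * diagJ m * Dqᵀ = 0) :
      -(X * diagJ m * Dq'ᵀ * T) * Dq' = X := by
    calc -(X * diagJ m * Dq'ᵀ * T) * Dq'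
        = -(X * diagJ m * (diagJ m - Dqᵀ * diagJ n_yq * Dq)) := by
          rw [← hsum, add_sub_cancel_left]; simp only [Matrix.neg_mul, Matrix.mul_assoc]
      _ = -(X * (diagJ m * diagJ m)) + X * diagJ m * Dqᵀ * (diagJ n_yq * Dq) := by
          rw [Matrix.mul_sub, neg_sub, sub_eq_neg_add]; simp only [Matrix.mul_assoc]
      _ = X := by simp [hX, diagJ_mul_self]
  have hDc : Dc * diagJ m * Dqᵀ = 0 := by
    have h := congrArg transpose h2
    simpa [transpose_mul, diagJ_transpose, Matrix.mul_assoc] using h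
  have hDcBc : Dc * diagJ m * Bcᵀ = 0 := by
    have h := congrArg transpose h7
    simpa [transpose_mul, diagJ_transpose, Matrix.mul_assoc] using h
  have hDcBq : Dc * diagJ m * Bqᵀ = -(Ccq * diagJ n_q) := by
    have h := congrArg transpose h8
    simpa [transpose_mul, diagJ_transpose, Matrix.mul_assoc, neg_eq_iff_eq_neg] using h
  have hB := hlift Bc h6
  have hD := hlift Dc hDc
  refine ⟨hT, -(diagJ m * Dqᵀ * diagJ n_yq * Cqc), -(Bc * diagJ m * Dq'ᵀ * T),
    -(Dc * diagJ m * Dq'ᵀ * T), ?_, ?_, hB, ?_, hD, ?_⟩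
  · calc Dq * -(diagJ m * Dqᵀ * diagJ n_yq * Cqc)
        = -((Dq * diagJ m * Dqᵀ) * diagJ n_yq * Cqc) := by
          simp only [Matrix.mul_neg, Matrix.mul_assoc]
      _ = Cqc := by simp [h1, diagJ_mul_self]
  · rw [← Matrix.mul_assoc, ← Matrix.mul_assoc, ← Matrix.mul_assoc, hB,
      eq_neg_of_add_eq_zero_right h4, Matrix.neg_mul, Matrix.mul_assoc, diagJ_mul_self]
    simp
  · rw [← Matrix.mul_assoc, ← Matrix.mul_assoc, ← Matrix.mul_assoc, hD, hDcBq,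
      Matrix.neg_mul, Matrix.mul_assoc, diagJ_mul_self]
    simp
  · have hBD : fromRows (-(Bc * diagJ m * Dq'ᵀ * T)) (-(Dc * diagJ m * Dq'ᵀ * T)) * Dq' =
        fromRows Bc Dc := by
      rw [fromRows_mul, hB, hD]
    generalize fromRows (-(Bc * diagJ m * Dq'ᵀ * T)) (-(Dc * diagJ m * Dq'ᵀ * T)) = Y at hBD ⊢
    calc Y * T * Yᵀ = (Y * Dq') * diagJ m * (Y * Dq')ᵀ := by
          rw [hTdef, transpose_mul]; simp only [Matrix.mul_assoc]
      _ = 0 := by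
          rw [hBD, fromRows_mul, transpose_fromRows, fromRows_mul_fromCols, h5, h7, hDcBc, h3,
            fromBlocks_zero]
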